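/- arXiv:2009.01662 — 7 statements merged into one kernel-verified Lean document; each statement's English description precedes it below -/
import Mathlib

section
/- Fix ε with 0 < ε < π/2. Then the limit as s → 0⁺ of ∫_ε^{π/2} h₁(q,s) dq equals ∫_ε^{π/2} (1/sin q) dq = ln(1/tan(ε/2)). -/
theorem sqrt_div_le_one_div {a : ℝ} (ha : 0 < a) (s : ℝ) :
    √((√(a ^ 4 + s ^ 2) + a ^ 2) / (2 * (a ^ 4 + s ^ 2))) ≤ 1 / a := by
  have hpos : 0 < a ^ 4 + s ^ 2 := by positivity
  obtain ⟨R, hR⟩ : ∃ R, R = √(a ^ 4 + s ^ 2) := ⟨_, rfl⟩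
  have hsq : R ^ 2 = a ^ 4 + s ^ 2 := by rw [hR, Real.sq_sqrt hpos.le]
  have hle : a ^ 2 ≤ R := by
    rw [hR]
    exact Real.le_sqrt_of_sq_le (by nlinarith [sq_nonneg s])
  have ha2 : 0 < a ^ 2 := by positivity
  rw [← hR, ← hsq]
  refine Real.sqrt_le_iff.mpr ⟨by positivity, ?_⟩
  rw [div_pow, one_pow, div_le_div_iff₀ (by nlinarith) ha2]
  nlinarith [mul_nonneg (ha2.trans_le hle).le (sub_nonneg.mpr hle)]

theorem tendsto_sqrt_div_one_div {a : ℝ} (ha : 0 < a) :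
    Filter.Tendsto (fun s : ℝ => √((√(a ^ 4 + s ^ 2) + a ^ 2) / (2 * (a ^ 4 + s ^ 2))))
      (nhds 0) (nhds (1 / a)) := by
  have hcont : Continuous
      (fun s : ℝ => √((√(a ^ 4 + s ^ 2) + a ^ 2) / (2 * (a ^ 4 + s ^ 2)))) := by
    refine (Continuous.div (by fun_prop) (by fun_prop) fun s => ?_).sqrt
    positivity
  have hval : √((√(a ^ 4 + 0 ^ 2) + a ^ 2) / (2 * (a ^ 4 + 0 ^ 2))) = 1 / a := by
    have h : √(a ^ 4 + 0 ^ 2) = a ^ 2 := by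
      rw [show a ^ 4 + 0 ^ 2 = (a ^ 2) ^ 2 by ring, Real.sqrt_sq (by positivity)]
    rw [h, show (a ^ 2 + a ^ 2) / (2 * (a ^ 4 + 0 ^ 2)) = (1 / a) ^ 2 by field_simp; ring,
      Real.sqrt_sq (by positivity)]
  have := hcont.tendsto 0
  rwa [hval] at this

theorem hasDerivAt_log_tan_half {q : ℝ} (h0 : 0 < q) (hpi : q < Real.pi) :
    HasDerivAt (fun x => Real.log (Real.tan (x / 2))) (1 / Real.sin q) q := by
  have hs : 0 < Real.sin (q / 2) := Real.sin_pos_of_pos_of_lt_pi (by linarith) (by linarith)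
  have hc : 0 < Real.cos (q / 2) := Real.cos_pos_of_mem_Ioo ⟨by linarith, by linarith⟩
  have ht : Real.tan (q / 2) ≠ 0 := by
    rw [Real.tan_eq_sin_div_cos]
    positivity
  have hd : HasDerivAt (fun x : ℝ => Real.tan (x / 2))
      (1 / Real.cos (q / 2) ^ 2 * (1 / 2)) q := by
    have hdiv : HasDerivAt (fun x : ℝ => x / 2) (1 / 2) q := (hasDerivAt_id q).div_const 2
    exact HasDerivAt.comp (h₂ := Real.tan) q (Real.hasDerivAt_tan hc.ne') hdiv
  convert hd.log ht using 1
  have h2 : Real.sin q = 2 * Real.sin (q / 2) * Real.cos (q / 2) := by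
    rw [← Real.sin_two_mul]
    ring_nf
  rw [h2, Real.tan_eq_sin_div_cos]
  field_simp

theorem h1_tail_limit (ε : ℝ) (hε : 0 < ε) (hε' : ε < Real.pi / 2) :
    Filter.Tendsto
      (fun s : ℝ => ∫ q in ε..(Real.pi / 2),
        Real.sqrt ((Real.sqrt (Real.sin q ^ 4 + s ^ 2) + Real.sin q ^ 2) /
          (2 * (Real.sin q ^ 4 + s ^ 2))))
      (nhdsWithin 0 (Set.Ioi 0))
      (nhds (∫ q in ε..(Real.pi / 2), 1 / Real.sin q)) ∧
    (∫ q in ε..(Real.pi / 2), 1 / Real.sin q) = Real.log (1 / Real.tan (ε / 2)) := by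
  have hbd : ∀ q ∈ Set.uIcc ε (Real.pi / 2), 0 < q ∧ q < Real.pi := by
    intro q hq
    rw [Set.uIcc_of_le hε'.le] at hq
    exact ⟨hε.trans_le hq.1, by linarith [hq.2]⟩
  have hsin : ∀ q ∈ Set.uIcc ε (Real.pi / 2), 0 < Real.sin q := fun q hq =>
    Real.sin_pos_of_pos_of_lt_pi (hbd q hq).1 (hbd q hq).2
  have hint : IntervalIntegrable (fun q => 1 / Real.sin q) MeasureTheory.volume
      ε (Real.pi / 2) :=
    (continuousOn_const.div Real.continuous_sin.continuousOn
      fun q hq => (hsin q hq).ne').intervalIntegrable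
  constructor
  · refine intervalIntegral.tendsto_integral_filter_of_dominated_convergence
      (fun q => 1 / Real.sin q) ?_ ?_ hint ?_
    · refine Filter.Eventually.of_forall fun s => Measurable.aestronglyMeasurable ?_
      fun_prop
    · refine Filter.Eventually.of_forall fun s => Filter.Eventually.of_forall fun q hq => ?_
      rw [Real.norm_of_nonneg (Real.sqrt_nonneg _)]
      exact sqrt_div_le_one_div (hsin q (Set.uIoc_subset_uIcc hq)) s
    · refine Filter.Eventually.of_forall fun q hq => ?_
      exact (tendsto_sqrt_div_one_div (hsin q (Set.uIoc_subset_uIcc hq))).mono_left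
        nhdsWithin_le_nhds
  · rw [intervalIntegral.integral_eq_sub_of_hasDerivAt
      (fun q hq => hasDerivAt_log_tan_half (hbd q hq).1 (hbd q hq).2) hint,
      show Real.pi / 2 / 2 = Real.pi / 4 by ring, Real.tan_pi_div_four, Real.log_one,
      one_div, Real.log_inv, zero_sub]
end

section
/- Fix ε with 0 < ε < π/2. Then the limit as s → 0⁺ of ∫_ε^{π/2} h₂(q,s) dq equals 0. -/
open Real Filter Topology

theorem sqrt_add_sq_sub_div_le {x c s : ℝ} (hc : 0 < c) (hcx : c ≤ x) (hs : 0 ≤ s) :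
    (√(x ^ 2 + s ^ 2) - x) / (2 * (x ^ 2 + s ^ 2)) ≤ s / (2 * c ^ 2) := by
  have hx : 0 < x := hc.trans_le hcx
  have hsqrt : √(x ^ 2 + s ^ 2) ≤ x + s :=
    Real.sqrt_le_iff.2 ⟨by positivity, by nlinarith [mul_nonneg hx.le hs]⟩
  have hsq : c ^ 2 ≤ x ^ 2 := by gcongr
  exact div_le_div₀ hs (by linarith) (by positivity) (by nlinarith [sq_nonneg s])

theorem h2_tail_limit (ε : ℝ) (hε : 0 < ε) (hε' : ε < Real.pi / 2) :
    Filter.Tendsto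
      (fun s : ℝ => ∫ q in ε..(Real.pi / 2),
        Real.sqrt ((Real.sqrt (Real.sin q ^ 4 + s ^ 2) - Real.sin q ^ 2) /
          (2 * (Real.sin q ^ 4 + s ^ 2))))
      (nhdsWithin 0 (Set.Ioi 0)) (nhds 0) := by
  have hsin : 0 < sin ε := sin_pos_of_pos_of_lt_pi hε (by linarith)
  have hbound : Tendsto (fun s : ℝ => √(s / (2 * (sin ε ^ 2) ^ 2)) * |π / 2 - ε|)
      (𝓝[>] 0) (𝓝 0) := by
    have hcont : Continuous fun s : ℝ => √(s / (2 * (sin ε ^ 2) ^ 2)) * |π / 2 - ε| := by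
      fun_prop
    exact (hcont.tendsto' 0 0 (by simp)).mono_left nhdsWithin_le_nhds
  refine squeeze_zero_norm' ?_ hbound
  filter_upwards [self_mem_nhdsWithin] with s hs
  refine intervalIntegral.norm_integral_le_of_norm_le_const fun q hq => ?_
  rw [Set.uIoc_of_le hε'.le] at hq
  have hmono : sin ε ≤ sin q :=
    sin_le_sin_of_le_of_le_pi_div_two (by linarith) hq.2 hq.1.le
  rw [norm_of_nonneg (sqrt_nonneg _), show sin q ^ 4 = (sin q ^ 2) ^ 2 by ring]
  exact sqrt_le_sqrt
    (sqrt_add_sq_sub_div_le (by positivity) (by gcongr) (le_of_lt hs))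
end

section
/- For every T ≥ 0, one has 2∫₀^T √((√(y⁴ + 1) + y²)/(2(y⁴ + 1))) dy = ln(√(φ(T)² − 1) + φ(T)), where φ(T) = √(T⁴ + 1) + T². -/
open Real

theorem hasDerivAt_sqrt_pow_four_add_one (y : ℝ) :
    HasDerivAt (fun x : ℝ => √(x ^ 4 + 1)) (2 * y ^ 3 / √(y ^ 4 + 1)) y := by
  have h : HasDerivAt (fun x : ℝ => x ^ 4 + 1) (4 * y ^ 3) y := by
    simpa using (hasDerivAt_pow 4 y).add_const (1 : ℝ)
  convert h.sqrt (by positivity) using 1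
  field_simp
  ring

theorem sqrt_div_two_mul_sq {s z : ℝ} (hs : 0 < s) :
    √(z / (2 * s ^ 2)) = √(2 * z) / (2 * s) := by
  rw [show z / (2 * s ^ 2) = 2 * z / (2 * s) ^ 2 by field_simp,
    Real.sqrt_div' _ (by positivity), Real.sqrt_sq (by positivity)]

theorem hasDerivAt_log_integral_plus {y : ℝ} (hy : 0 ≤ y) :
    HasDerivAt (fun x : ℝ => Real.log (x * √(2 * (√(x ^ 4 + 1) + x ^ 2)) + (√(x ^ 4 + 1) + x ^ 2)))
      (2 * √((√(y ^ 4 + 1) + y ^ 2) / (2 * (y ^ 4 + 1)))) y := by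
  have hs : 0 < √(y ^ 4 + 1) := Real.sqrt_pos.2 (by positivity)
  have hs2 : √(y ^ 4 + 1) ^ 2 = y ^ 4 + 1 := Real.sq_sqrt (by positivity)
  have hz : HasDerivAt (fun x : ℝ => √(x ^ 4 + 1) + x ^ 2)
      (2 * y ^ 3 / √(y ^ 4 + 1) + 2 * y) y := by
    exact ((hasDerivAt_sqrt_pow_four_add_one y).add (hasDerivAt_pow 2 y)).congr_deriv (by simp)
  have hw := (hz.const_mul 2).sqrt (by positivity)
  have h := (((hasDerivAt_id' y).mul hw).add hz).log (by
    simp only [Pi.add_apply, Pi.mul_apply]; positivity)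
  refine h.congr_deriv ?_
  simp only [Pi.add_apply, Pi.mul_apply]
  rw [← hs2, sqrt_div_two_mul_sq hs, hs2]
  have hw0 : 0 < √(2 * (√(y ^ 4 + 1) + y ^ 2)) := Real.sqrt_pos.2 (by positivity)
  have hw2 : √(2 * (√(y ^ 4 + 1) + y ^ 2)) ^ 2 = 2 * (√(y ^ 4 + 1) + y ^ 2) :=
    Real.sq_sqrt (by positivity)
  generalize √(2 * (√(y ^ 4 + 1) + y ^ 2)) = w at *
  generalize √(y ^ 4 + 1) = s at *
  have hd : 0 < y * w + (s + y ^ 2) := by positivity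
  rw [div_eq_iff hd.ne']
  field_simp
  linear_combination (-y * w - y ^ 2) * hw2

theorem sqrt_sq_sub_one_eq {T : ℝ} (hT : 0 ≤ T) :
    √((√(T ^ 4 + 1) + T ^ 2) ^ 2 - 1) = T * √(2 * (√(T ^ 4 + 1) + T ^ 2)) := by
  have hs2 : √(T ^ 4 + 1) ^ 2 = T ^ 4 + 1 := Real.sq_sqrt (by positivity)
  rw [show (√(T ^ 4 + 1) + T ^ 2) ^ 2 - 1 = T ^ 2 * (2 * (√(T ^ 4 + 1) + T ^ 2)) by
    linear_combination hs2, Real.sqrt_mul (sq_nonneg T), Real.sqrt_sq hT]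

theorem integral_plus_eval (T : ℝ) (hT : 0 ≤ T) :
    2 * ∫ y in (0:ℝ)..T,
        Real.sqrt ((Real.sqrt (y ^ 4 + 1) + y ^ 2) / (2 * (y ^ 4 + 1))) =
      Real.log (Real.sqrt ((Real.sqrt (T ^ 4 + 1) + T ^ 2) ^ 2 - 1) +
        (Real.sqrt (T ^ 4 + 1) + T ^ 2)) := by
  have hc : Continuous fun y : ℝ => 2 * √((√(y ^ 4 + 1) + y ^ 2) / (2 * (y ^ 4 + 1))) := by
    refine continuous_const.mul (Continuous.sqrt (Continuous.div ?_ ?_ fun y => by positivity)) <;>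
      fun_prop
  rw [← intervalIntegral.integral_const_mul,
    intervalIntegral.integral_eq_sub_of_hasDerivAt
      (fun y hy => hasDerivAt_log_integral_plus (Set.uIcc_of_le hT ▸ hy).1)
      (hc.intervalIntegrable 0 T), sqrt_sq_sub_one_eq hT]
  simp
end

section
/- For every T ≥ 0, one has 2∫₀^T √((√(y⁴ + 1) − y²)/(2(y⁴ + 1))) dy = π/2 − arcsin(ψ(T)), where ψ(T) = √(T⁴ + 1) − T². -/
open Real

lemma sq_lt_sqrt_pow_four_add_one (y : ℝ) : y ^ 2 < √(y ^ 4 + 1) :=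
  Real.lt_sqrt_of_sq_lt (by ring_nf; linarith)

lemma hasDerivAt_arcsin_sqrt_pow_four_add_one_sub_sq {y : ℝ} (hy : 0 < y) :
    HasDerivAt (fun y : ℝ => -arcsin (√(y ^ 4 + 1) - y ^ 2))
      (2 * √((√(y ^ 4 + 1) - y ^ 2) / (2 * (y ^ 4 + 1)))) y := by
  have hs2 : √(y ^ 4 + 1) ^ 2 = y ^ 4 + 1 := Real.sq_sqrt (by positivity)
  have hs0 : 0 < √(y ^ 4 + 1) := by positivity
  have hsqrt : HasDerivAt (fun y : ℝ => √(y ^ 4 + 1)) (4 * y ^ 3 / (2 * √(y ^ 4 + 1))) y := by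
    simpa using ((hasDerivAt_pow 4 y).add_const 1).sqrt (by positivity)
  have hsub := hsqrt.sub (hasDerivAt_pow 2 y)
  have hz0 := sub_pos.2 (sq_lt_sqrt_pow_four_add_one y)
  have hz1 : √(y ^ 4 + 1) - y ^ 2 < 1 := by nlinarith [pow_pos hy 2]
  have h := ((hasDerivAt_arcsin (by linarith) hz1.ne).comp y hsub).neg
  refine h.congr_deriv ?_
  set s := √(y ^ 4 + 1)
  rw [← hs2]
  obtain ⟨r, hr0, hr⟩ : ∃ r : ℝ, 0 < r ∧ r ^ 2 = 2 * (s - y ^ 2) :=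
    ⟨√(2 * (s - y ^ 2)), by positivity, Real.sq_sqrt (by positivity)⟩
  have h1 : √(1 - (s - y ^ 2) ^ 2) = y * r := by
    rw [← Real.sqrt_sq (by positivity : 0 ≤ y * r)]
    congr 1
    linear_combination -hs2 - y ^ 2 * hr
  have h2 : √((s - y ^ 2) / (2 * s ^ 2)) = r / (2 * s) := by
    rw [← Real.sqrt_sq (by positivity : 0 ≤ r / (2 * s)), div_pow, hr]
    congr 1
    field_simp
  rw [h1, h2]
  field_simp
  push_cast
  linear_combination -2 * y * hr

theorem integral_minus_eval (T : ℝ) (hT : 0 ≤ T) :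
    2 * ∫ y in (0:ℝ)..T,
        Real.sqrt ((Real.sqrt (y ^ 4 + 1) - y ^ 2) / (2 * (y ^ 4 + 1))) =
      Real.pi / 2 - Real.arcsin (Real.sqrt (T ^ 4 + 1) - T ^ 2) := by
  rw [← intervalIntegral.integral_const_mul,
    intervalIntegral.integral_eq_sub_of_hasDerivAt_of_le hT
      (f := fun y : ℝ => -arcsin (√(y ^ 4 + 1) - y ^ 2)) (by fun_prop)
      (fun y hy => hasDerivAt_arcsin_sqrt_pow_four_add_one_sub_sq hy.1)
      (Continuous.intervalIntegrable (by fun_prop (disch := intros; positivity)) 0 T)]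
  simp
  ring
end

section
/- The improper integral ∫₀^∞ √((√(y⁴ + 1) − y²)/(2(y⁴ + 1))) dy converges and equals π/4. -/
open Real MeasureTheory

lemma hasDerivAt_neg_half_arcsin_sqrt_sub_sq {y : ℝ} (hy : 0 < y) :
    HasDerivAt (fun y : ℝ => -(1 / 2) * Real.arcsin (Real.sqrt (y ^ 4 + 1) - y ^ 2))
      (Real.sqrt ((Real.sqrt (y ^ 4 + 1) - y ^ 2) / (2 * (y ^ 4 + 1)))) y := by
  have hp : 0 < y ^ 4 + 1 := by positivity
  have hd : HasDerivAt (fun y : ℝ => Real.sqrt (y ^ 4 + 1) - y ^ 2)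
      (4 * y ^ 3 / (2 * Real.sqrt (y ^ 4 + 1)) - 2 * y) y := by
    have h₁ : HasDerivAt (fun y : ℝ => y ^ 4 + 1) (4 * y ^ 3) y := by
      simpa using (hasDerivAt_pow 4 y).add_const 1
    have h₂ : HasDerivAt (fun y : ℝ => y ^ 2) (2 * y) y := by
      simpa using hasDerivAt_pow 2 y
    exact (h₁.sqrt hp.ne').sub h₂
  have hs : 0 < Real.sqrt (y ^ 4 + 1) := Real.sqrt_pos.2 hp
  have hss : Real.sqrt (y ^ 4 + 1) ^ 2 = y ^ 4 + 1 := Real.sq_sqrt hp.le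
  set s := Real.sqrt (y ^ 4 + 1)
  have hy2 : 0 < y ^ 2 := by positivity
  have hu : 0 < s - y ^ 2 := by nlinarith
  have hu1 : s - y ^ 2 < 1 := by nlinarith
  have key := ((Real.hasDerivAt_arcsin (by linarith) hu1.ne).comp y hd).const_mul (-(1 / 2))
  refine key.congr_deriv ?_
  have h₁ : Real.sqrt (1 - (s - y ^ 2) ^ 2) = y * Real.sqrt (2 * (s - y ^ 2)) := by
    rw [show 1 - (s - y ^ 2) ^ 2 = y ^ 2 * (2 * (s - y ^ 2)) by linear_combination -hss,
      Real.sqrt_mul hy2.le, Real.sqrt_sq hy.le]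
  have h₂ : Real.sqrt ((s - y ^ 2) / (2 * (y ^ 4 + 1))) =
      Real.sqrt (2 * (s - y ^ 2)) / (2 * s) := by
    rw [← hss, show (s - y ^ 2) / (2 * s ^ 2) = 2 * (s - y ^ 2) / (2 * s) ^ 2 by field_simp,
      Real.sqrt_div (by positivity), Real.sqrt_sq (by positivity)]
  rw [h₁, h₂]
  have hr : 0 < Real.sqrt (2 * (s - y ^ 2)) := Real.sqrt_pos.2 (by positivity)
  have hrr : Real.sqrt (2 * (s - y ^ 2)) ^ 2 = 2 * (s - y ^ 2) := Real.sq_sqrt (by positivity)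
  set r := Real.sqrt (2 * (s - y ^ 2))
  field_simp
  linear_combination -2 * hrr

lemma tendsto_sqrt_sub_sq_atTop :
    Filter.Tendsto (fun y : ℝ => Real.sqrt (y ^ 4 + 1) - y ^ 2) Filter.atTop (nhds 0) := by
  have hinv : Filter.Tendsto (fun y : ℝ => (y ^ 2)⁻¹) Filter.atTop (nhds 0) :=
    tendsto_inv_atTop_zero.comp (Filter.tendsto_pow_atTop two_ne_zero)
  refine tendsto_of_tendsto_of_tendsto_of_le_of_le' tendsto_const_nhds hinv ?_ ?_
  · filter_upwards with y
    exact sub_nonneg.2 (Real.le_sqrt_of_sq_le (by nlinarith))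
  · filter_upwards [Filter.eventually_gt_atTop 0] with y hy
    rw [sub_le_iff_le_add]
    refine Real.sqrt_le_iff.2 ⟨by positivity, ?_⟩
    have h : (y ^ 2)⁻¹ * y ^ 2 = 1 := inv_mul_cancel₀ (by positivity)
    nlinarith [sq_nonneg (y ^ 2)⁻¹]

theorem improper_integral_minus :
    MeasureTheory.IntegrableOn
      (fun y : ℝ => Real.sqrt ((Real.sqrt (y ^ 4 + 1) - y ^ 2) / (2 * (y ^ 4 + 1))))
      (Set.Ioi 0) ∧
    (∫ y in Set.Ioi (0:ℝ),
        Real.sqrt ((Real.sqrt (y ^ 4 + 1) - y ^ 2) / (2 * (y ^ 4 + 1)))) =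
      Real.pi / 4 := by
  have hcont : Continuous
      (fun y : ℝ => -(1 / 2) * Real.arcsin (Real.sqrt (y ^ 4 + 1) - y ^ 2)) :=
    continuous_const.mul (Real.continuous_arcsin.comp (by fun_prop))
  have hlim : Filter.Tendsto
      (fun y : ℝ => -(1 / 2) * Real.arcsin (Real.sqrt (y ^ 4 + 1) - y ^ 2))
      Filter.atTop (nhds 0) := by
    simpa using ((Real.continuous_arcsin.tendsto 0).comp tendsto_sqrt_sub_sq_atTop).const_mul
      (-(1 / 2) : ℝ)
  refine ⟨integrableOn_Ioi_deriv_of_nonneg hcont.continuousWithinAt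
    (fun y hy => hasDerivAt_neg_half_arcsin_sqrt_sub_sq hy) (fun _ _ => Real.sqrt_nonneg _) hlim, ?_⟩
  rw [integral_Ioi_of_hasDerivAt_of_nonneg hcont.continuousWithinAt
    (fun y hy => hasDerivAt_neg_half_arcsin_sqrt_sub_sq hy) (fun _ _ => Real.sqrt_nonneg _) hlim]
  norm_num
  ring
end

section
/- The limit as s → 0⁺ of [∫₀^π h₁(q,s) dq − ln(16/s)] equals 0. -/
open Real Filter Topology

/-- The real part of `1 / √(x ^ 2 + i s)`. -/
noncomputable def invSqrtRe (s x : ℝ) : ℝ :=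
  √((√(x ^ 4 + s ^ 2) + x ^ 2) / (2 * (x ^ 4 + s ^ 2)))

/-- The real part of `log (x + √(x ^ 2 + i s))`. -/
noncomputable def logAddSqrtRe (s x : ℝ) : ℝ :=
  1 / 2 * Real.log (x ^ 2 + 2 * x * √((√(x ^ 4 + s ^ 2) + x ^ 2) / 2) + √(x ^ 4 + s ^ 2))

lemma invSqrtRe_eq_div {s : ℝ} (x : ℝ) :
    invSqrtRe s x = √((√(x ^ 4 + s ^ 2) + x ^ 2) / 2) / √(x ^ 4 + s ^ 2) := by
  rw [invSqrtRe, ← Real.sqrt_div' _ (by positivity), div_div]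

lemma hasDerivAt_logAddSqrtRe {s x : ℝ} (hs : 0 < s) (hx : 0 ≤ x) :
    HasDerivAt (logAddSqrtRe s) (invSqrtRe s x) x := by
  have hpos : 0 < x ^ 4 + s ^ 2 := by positivity
  have hr : 0 < √(x ^ 4 + s ^ 2) := Real.sqrt_pos.2 hpos
  have hu : 0 < √((√(x ^ 4 + s ^ 2) + x ^ 2) / 2) := Real.sqrt_pos.2 (by positivity)
  have hdr : HasDerivAt (fun y : ℝ => √(y ^ 4 + s ^ 2)) (2 * x ^ 3 / √(x ^ 4 + s ^ 2)) x := by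
    have h := ((hasDerivAt_pow 4 x).add_const (s ^ 2)).sqrt hpos.ne'
    refine h.congr_deriv ?_
    field_simp
    norm_num
  have hu2 := Real.sq_sqrt (show 0 ≤ (√(x ^ 4 + s ^ 2) + x ^ 2) / 2 by positivity)
  have hdu : HasDerivAt (fun y : ℝ => √((√(y ^ 4 + s ^ 2) + y ^ 2) / 2))
      (x * √((√(x ^ 4 + s ^ 2) + x ^ 2) / 2) / √(x ^ 4 + s ^ 2)) x := by
    have h := ((hdr.fun_add (hasDerivAt_pow 2 x)).div_const 2).sqrt (Real.sqrt_pos.1 hu).ne'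
    refine h.congr_deriv ?_
    generalize √((√(x ^ 4 + s ^ 2) + x ^ 2) / 2) = u at *
    generalize √(x ^ 4 + s ^ 2) = r at *
    field_simp
    push_cast
    linear_combination (-4) * x * hu2
  have h := (((((hasDerivAt_pow 2 x).fun_add
    (((hasDerivAt_id' x).const_mul 2).fun_mul hdu)).fun_add hdr).log (by positivity)).const_mul (1 / 2))
  refine h.congr_deriv ?_
  rw [invSqrtRe_eq_div]
  generalize √((√(x ^ 4 + s ^ 2) + x ^ 2) / 2) = u at *
  generalize √(x ^ 4 + s ^ 2) = r at *
  have : 0 < x ^ 2 + 2 * x * u + r := by positivity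
  field_simp
  push_cast
  linear_combination (-4) * x * hu2

lemma continuous_invSqrtRe {s : ℝ} (hs : 0 < s) : Continuous (invSqrtRe s) := by
  unfold invSqrtRe
  refine Real.continuous_sqrt.comp (Continuous.div (by fun_prop) (by fun_prop) fun x => ?_)
  positivity

lemma invSqrtRe_nonneg (s x : ℝ) : 0 ≤ invSqrtRe s x := Real.sqrt_nonneg _

lemma invSqrtRe_le_inv (s : ℝ) {x : ℝ} (hx : 0 < x) : invSqrtRe s x ≤ x⁻¹ := by
  rw [invSqrtRe, Real.sqrt_le_left (by positivity)]
  have hr : x ^ 2 ≤ √(x ^ 4 + s ^ 2) := Real.le_sqrt_of_sq_le (by nlinarith [sq_nonneg s])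
  have hr2 := Real.sq_sqrt (show 0 ≤ x ^ 4 + s ^ 2 by positivity)
  have hden : 2 * (x ^ 4 + s ^ 2) = 2 * √(x ^ 4 + s ^ 2) ^ 2 := by rw [hr2]
  rw [hden]
  generalize √(x ^ 4 + s ^ 2) = r at *
  have hx2 : 0 < x ^ 2 := by positivity
  have : 0 < r := hx2.trans_le hr
  rw [inv_pow, div_le_iff₀ (by positivity), inv_mul_eq_div, le_div_iff₀ hx2]
  nlinarith

lemma tendsto_invSqrtRe {x : ℝ} (hx : 0 < x) :
    Tendsto (fun s => invSqrtRe s x) (𝓝 0) (𝓝 x⁻¹) := by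
  have h : ContinuousAt (fun s => invSqrtRe s x) 0 := by
    unfold invSqrtRe
    refine ContinuousAt.sqrt (ContinuousAt.div (by fun_prop) (by fun_prop) ?_)
    positivity
  have h0 : invSqrtRe 0 x = x⁻¹ := by
    have hr : √(x ^ 4 + 0 ^ 2) = x ^ 2 := by
      rw [show x ^ 4 + 0 ^ 2 = (x ^ 2) ^ 2 by ring, Real.sqrt_sq (by positivity)]
    rw [invSqrtRe_eq_div, hr, add_self_div_two, Real.sqrt_sq hx.le]
    field_simp
  simpa only [ContinuousAt, h0] using h

lemma integral_invSqrtRe_sin {s : ℝ} (hs : 0 < s) :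
    ∫ q in (0 : ℝ)..π, invSqrtRe s (sin q) =
      2 * ((∫ q in (0 : ℝ)..π / 2, invSqrtRe s (sin q) * (1 - cos q)) +
        ∫ q in (0 : ℝ)..π / 2, invSqrtRe s (sin q) * cos q) := by
  have hc : Continuous fun q => invSqrtRe s (sin q) := (continuous_invSqrtRe hs).comp continuous_sin
  have hsymm : ∫ q in π / 2..π, invSqrtRe s (sin q) =
      ∫ q in (0 : ℝ)..π / 2, invSqrtRe s (sin q) := by
    have h := intervalIntegral.integral_comp_sub_left (a := 0) (b := π / 2)
      (fun q => invSqrtRe s (sin q)) π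
    simp only [sin_pi_sub, sub_zero, sub_half] at h
    exact h.symm
  rw [← intervalIntegral.integral_add ((by fun_prop : Continuous _).intervalIntegrable _ _)
      ((by fun_prop : Continuous _).intervalIntegrable _ _),
    ← intervalIntegral.integral_add_adjacent_intervals (hc.intervalIntegrable _ (π / 2))
      (hc.intervalIntegrable _ _), hsymm, ← two_mul]
  congr 2 with q
  ring

lemma integral_invSqrtRe_sin_mul_cos {s : ℝ} (hs : 0 < s) :
    ∫ q in (0 : ℝ)..π / 2, invSqrtRe s (sin q) * cos q =
      logAddSqrtRe s 1 - 1 / 2 * Real.log s := by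
  have hc : Continuous fun q => invSqrtRe s (sin q) := (continuous_invSqrtRe hs).comp continuous_sin
  rw [intervalIntegral.integral_eq_sub_of_hasDerivAt (f := fun q => logAddSqrtRe s (sin q))
    (fun q hq => ?_) ((by fun_prop : Continuous _).intervalIntegrable _ _)]
  · simp [logAddSqrtRe, Real.sqrt_sq hs.le]
  · rw [Set.uIcc_of_le (by positivity)] at hq
    exact (hasDerivAt_logAddSqrtRe hs
      (sin_nonneg_of_nonneg_of_le_pi hq.1 (by linarith [hq.2, pi_pos]))).comp q (hasDerivAt_sin q)

lemma tendsto_logAddSqrtRe_one : Tendsto (fun s => logAddSqrtRe s 1) (𝓝 0) (𝓝 (Real.log 2)) := by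
  have h : ContinuousAt (fun s => logAddSqrtRe s 1) 0 := by
    unfold logAddSqrtRe
    exact ContinuousAt.mul (by fun_prop) (ContinuousAt.log (by fun_prop) (by positivity))
  have h0 : logAddSqrtRe 0 1 = Real.log 2 := by
    have h4 : Real.log 4 = 2 * Real.log 2 := by
      rw [show (4 : ℝ) = 2 ^ 2 by norm_num, Real.log_pow]; norm_num
    norm_num [logAddSqrtRe, h4]
    ring
  simpa only [ContinuousAt, h0] using h

lemma integral_sin_div_one_add_cos :
    ∫ q in (0 : ℝ)..π / 2, sin q / (1 + cos q) = Real.log 2 := by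
  have hpos : ∀ q ∈ Set.uIcc 0 (π / 2), 0 < 1 + cos q := fun q hq => by
    rw [Set.uIcc_of_le (by positivity)] at hq
    linarith [cos_nonneg_of_neg_pi_div_two_le_of_le (by linarith [hq.1, pi_pos]) hq.2]
  rw [intervalIntegral.integral_eq_sub_of_hasDerivAt (f := fun q => -Real.log (1 + cos q))
    (f' := fun q => sin q / (1 + cos q))
    (fun q hq => ?_) (ContinuousOn.intervalIntegrable
      (ContinuousOn.div (by fun_prop) (by fun_prop) fun q hq => (hpos q hq).ne'))]
  · norm_num
  · refine (((hasDerivAt_cos q).const_add 1).log (hpos q hq).ne').neg.congr_deriv ?_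
    ring

lemma tendsto_integral_invSqrtRe_sin_mul_one_sub_cos :
    Tendsto (fun s => ∫ q in (0 : ℝ)..π / 2, invSqrtRe s (sin q) * (1 - cos q))
      (𝓝[>] 0) (𝓝 (Real.log 2)) := by
  rw [← integral_sin_div_one_add_cos]
  have hpi : (0 : ℝ) ≤ π / 2 := by positivity
  refine intervalIntegral.tendsto_integral_filter_of_dominated_convergence (fun _ => 1) ?_ ?_
    intervalIntegrable_const ?_
  · filter_upwards [self_mem_nhdsWithin] with s hs
    have hc : Continuous fun q => invSqrtRe s (sin q) :=
      (continuous_invSqrtRe hs).comp continuous_sin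
    exact (by fun_prop : Continuous _).aestronglyMeasurable
  · refine Eventually.of_forall fun s => MeasureTheory.ae_of_all _ fun q hq => ?_
    rw [Set.uIoc_of_le hpi] at hq
    have hsin : 0 < sin q := sin_pos_of_pos_of_lt_pi hq.1 (by linarith [hq.2, pi_pos])
    have hcos : 0 ≤ cos q :=
      cos_nonneg_of_neg_pi_div_two_le_of_le (by linarith [hq.1, pi_pos]) hq.2
    have h1 : 0 ≤ 1 - cos q := sub_nonneg.2 (cos_le_one q)
    rw [Real.norm_of_nonneg (mul_nonneg (invSqrtRe_nonneg _ _) h1)]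
    calc invSqrtRe s (sin q) * (1 - cos q) ≤ (sin q)⁻¹ * sin q :=
          mul_le_mul (invSqrtRe_le_inv s hsin)
            (by nlinarith [sin_sq_add_cos_sq q]) h1 (by positivity)
      _ = 1 := inv_mul_cancel₀ hsin.ne'
  · refine MeasureTheory.ae_of_all _ fun q hq => ?_
    rw [Set.uIoc_of_le hpi] at hq
    have hsin : 0 < sin q := sin_pos_of_pos_of_lt_pi hq.1 (by linarith [hq.2, pi_pos])
    have hcos : 0 ≤ cos q :=
      cos_nonneg_of_neg_pi_div_two_le_of_le (by linarith [hq.1, pi_pos]) hq.2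
    have heq : sin q / (1 + cos q) = (sin q)⁻¹ * (1 - cos q) := by
      field_simp
      linarith [sin_sq_add_cos_sq q]
    rw [heq]
    exact ((tendsto_invSqrtRe hsin).mono_left nhdsWithin_le_nhds).mul_const _

theorem h1_full_asymptotics :
    Filter.Tendsto
      (fun s : ℝ =>
        (∫ q in (0:ℝ)..Real.pi,
          Real.sqrt ((Real.sqrt (Real.sin q ^ 4 + s ^ 2) + Real.sin q ^ 2) /
            (2 * (Real.sin q ^ 4 + s ^ 2)))) - Real.log (16 / s))
      (nhdsWithin 0 (Set.Ioi 0)) (nhds 0) := by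
  have hlim := ((tendsto_integral_invSqrtRe_sin_mul_one_sub_cos.add
    (tendsto_logAddSqrtRe_one.mono_left nhdsWithin_le_nhds)).const_mul 2).sub_const (Real.log 16)
  have h16 : Real.log 16 = 4 * Real.log 2 := by
    rw [show (16 : ℝ) = 2 ^ 4 by norm_num, Real.log_pow]; norm_num
  rw [show 2 * (Real.log 2 + Real.log 2) - Real.log 16 = 0 by rw [h16]; ring] at hlim
  refine hlim.congr' ?_
  filter_upwards [self_mem_nhdsWithin] with s hs
  have hs : 0 < s := hs
  have h := integral_invSqrtRe_sin hs
  rw [integral_invSqrtRe_sin_mul_cos hs] at h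
  simp only [invSqrtRe] at h ⊢
  rw [h, Real.log_div (by norm_num) hs.ne']
  ring
end

section
/- The limit as s → 0⁺ of ∫₀^π h₂(q,s) dq equals π/2. -/
open Real Filter Topology

/-- The real part of `√(x² + i s)`. -/
noncomputable def sqrtRe (s x : ℝ) : ℝ := √((√(x ^ 4 + s ^ 2) + x ^ 2) / 2)

/-- The imaginary part of `√(x² + i s)` for `0 ≤ s`. -/
noncomputable def sqrtIm (s x : ℝ) : ℝ := √((√(x ^ 4 + s ^ 2) - x ^ 2) / 2)

lemma sq_lt_sqrt_pow_four_add_sq {s : ℝ} (hs : 0 < s) (x : ℝ) : x ^ 2 < √(x ^ 4 + s ^ 2) := by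
  apply Real.lt_sqrt_of_sq_lt
  nlinarith [pow_pos hs 2]

lemma sqrt_pow_four_add_sq_le {s : ℝ} (hs : 0 < s) (x : ℝ) : √(x ^ 4 + s ^ 2) ≤ x ^ 2 + s := by
  apply Real.sqrt_le_iff.2 ⟨by positivity, ?_⟩
  nlinarith [mul_nonneg (sq_nonneg x) hs.le]

lemma sqrt_div_eq_sqrtIm_div (s x : ℝ) :
    √((√(x ^ 4 + s ^ 2) - x ^ 2) / (2 * (x ^ 4 + s ^ 2))) = sqrtIm s x / √(x ^ 4 + s ^ 2) := by
  rw [sqrtIm, ← Real.sqrt_div' _ (by positivity), div_div]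

lemma hasDerivAt_sqrt_pow_four_add_sq {s : ℝ} (hs : 0 < s) (x : ℝ) :
    HasDerivAt (fun x : ℝ => √(x ^ 4 + s ^ 2)) (2 * x ^ 3 / √(x ^ 4 + s ^ 2)) x := by
  have h : HasDerivAt (fun x : ℝ => x ^ 4 + s ^ 2) (4 * x ^ 3) x := by
    simpa using (hasDerivAt_pow 4 x).add_const (s ^ 2)
  convert h.sqrt (by positivity) using 1
  field_simp
  ring

lemma hasDerivAt_sqrtRe {s : ℝ} (hs : 0 < s) (x : ℝ) :
    HasDerivAt (sqrtRe s) (x * sqrtRe s x / √(x ^ 4 + s ^ 2)) x := by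
  have hR0 : 0 < √(x ^ 4 + s ^ 2) := by positivity
  have hpos : 0 < (√(x ^ 4 + s ^ 2) + x ^ 2) / 2 := by positivity
  have ha : 0 < sqrtRe s x := Real.sqrt_pos.2 hpos
  have ha2 : sqrtRe s x ^ 2 = (√(x ^ 4 + s ^ 2) + x ^ 2) / 2 := Real.sq_sqrt hpos.le
  have h := (((hasDerivAt_sqrt_pow_four_add_sq hs x).add (hasDerivAt_pow 2 x)).div_const 2).sqrt
    hpos.ne'
  refine h.congr_deriv ?_
  change _ / (2 * sqrtRe s x) = _
  field_simp
  rw [ha2]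
  push_cast
  ring

lemma hasDerivAt_sqrtIm {s : ℝ} (hs : 0 < s) (x : ℝ) :
    HasDerivAt (sqrtIm s) (-(x * sqrtIm s x / √(x ^ 4 + s ^ 2))) x := by
  have hR := sq_lt_sqrt_pow_four_add_sq hs x
  have hR0 : 0 < √(x ^ 4 + s ^ 2) := by positivity
  have hpos : 0 < (√(x ^ 4 + s ^ 2) - x ^ 2) / 2 := by linarith
  have hb : 0 < sqrtIm s x := Real.sqrt_pos.2 hpos
  have hb2 : sqrtIm s x ^ 2 = (√(x ^ 4 + s ^ 2) - x ^ 2) / 2 := Real.sq_sqrt hpos.le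
  have h := (((hasDerivAt_sqrt_pow_four_add_sq hs x).sub (hasDerivAt_pow 2 x)).div_const 2).sqrt
    hpos.ne'
  refine h.congr_deriv ?_
  change _ / (2 * sqrtIm s x) = _
  field_simp
  rw [hb2]
  push_cast
  ring

lemma hasDerivAt_arctan_sqrtIm_div {s : ℝ} (hs : 0 < s) {x : ℝ} (hx : 0 ≤ x) :
    HasDerivAt (fun x => arctan (sqrtIm s x / (x + sqrtRe s x)))
      (-(sqrtIm s x / √(x ^ 4 + s ^ 2))) x := by
  have hR := sq_lt_sqrt_pow_four_add_sq hs x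
  have hR0 : 0 < √(x ^ 4 + s ^ 2) := by positivity
  have ha : 0 < sqrtRe s x := Real.sqrt_pos.2 (by positivity)
  have ha2 : sqrtRe s x ^ 2 = (√(x ^ 4 + s ^ 2) + x ^ 2) / 2 := Real.sq_sqrt (by positivity)
  have hb2 : sqrtIm s x ^ 2 = (√(x ^ 4 + s ^ 2) - x ^ 2) / 2 := Real.sq_sqrt (by linarith)
  have hxa : 0 < x + sqrtRe s x := by positivity
  have h := ((hasDerivAt_sqrtIm hs x).div ((hasDerivAt_id x).add (hasDerivAt_sqrtRe hs x))
    hxa.ne').arctan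
  refine h.congr_deriv ?_
  simp only [Pi.div_apply, Pi.add_apply, id_eq]
  generalize sqrtRe s x = a at *
  generalize sqrtIm s x = b at *
  generalize √(x ^ 4 + s ^ 2) = R at *
  have hden : (x + a) ^ 2 + b ^ 2 ≠ 0 := by positivity
  field_simp
  linear_combination b * (ha2 + hb2)

lemma continuous_sqrtIm_div {s : ℝ} (hs : 0 < s) :
    Continuous (fun q : ℝ => sqrtIm s (sin q) / √(sin q ^ 4 + s ^ 2)) := by
  unfold sqrtIm
  refine Continuous.div (by fun_prop) (by fun_prop) fun q => ?_
  positivity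

lemma integral_sqrtIm_div_mul_cos {s : ℝ} (hs : 0 < s) :
    ∫ q in (0 : ℝ)..π / 2, sqrtIm s (sin q) / √(sin q ^ 4 + s ^ 2) * cos q =
      π / 4 - arctan (sqrtIm s 1 / (1 + sqrtRe s 1)) := by
  have hderiv : ∀ q ∈ Set.uIcc 0 (π / 2),
      HasDerivAt (fun q => -arctan (sqrtIm s (sin q) / (sin q + sqrtRe s (sin q))))
        (sqrtIm s (sin q) / √(sin q ^ 4 + s ^ 2) * cos q) q := by
    intro q hq
    rw [Set.uIcc_of_le (by positivity)] at hq
    have hsin : 0 ≤ sin q := sin_nonneg_of_nonneg_of_le_pi hq.1 (by linarith [hq.2, pi_pos])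
    refine ((hasDerivAt_arctan_sqrtIm_div hs hsin).comp q (hasDerivAt_sin q)).neg.congr_deriv ?_
    ring
  rw [intervalIntegral.integral_eq_sub_of_hasDerivAt hderiv
    (((continuous_sqrtIm_div hs).mul continuous_cos).intervalIntegrable _ _)]
  have h0 : sqrtIm s 0 / (0 + sqrtRe s 0) = 1 := by
    have : sqrtIm s 0 = sqrtRe s 0 := by simp [sqrtIm, sqrtRe]
    rw [this, zero_add]
    exact div_self (Real.sqrt_pos.2 (by positivity)).ne'
  rw [sin_pi_div_two, sin_zero, h0, arctan_one]
  ring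

lemma sqrtIm_div_mul_sq_le {s : ℝ} (hs : 0 < s) (x : ℝ) :
    sqrtIm s x / √(x ^ 4 + s ^ 2) * x ^ 2 ≤ √s := by
  have hR := sq_lt_sqrt_pow_four_add_sq hs x
  have hR0 : 0 < √(x ^ 4 + s ^ 2) := by positivity
  have hb : 0 ≤ sqrtIm s x := Real.sqrt_nonneg _
  calc sqrtIm s x / √(x ^ 4 + s ^ 2) * x ^ 2
      ≤ sqrtIm s x / √(x ^ 4 + s ^ 2) * √(x ^ 4 + s ^ 2) := by gcongr
    _ = sqrtIm s x := div_mul_cancel₀ _ hR0.ne'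
    _ ≤ √s := Real.sqrt_le_sqrt (by linarith [sqrt_pow_four_add_sq_le hs x])

lemma abs_integral_sqrtIm_div_sub_le {s : ℝ} (hs : 0 < s) :
    |(∫ q in (0 : ℝ)..π / 2, sqrtIm s (sin q) / √(sin q ^ 4 + s ^ 2)) -
      (π / 4 - arctan (sqrtIm s 1 / (1 + sqrtRe s 1)))| ≤ √s * (π / 2) := by
  have hcont := continuous_sqrtIm_div hs
  have hcont' : Continuous fun q => sqrtIm s (sin q) / √(sin q ^ 4 + s ^ 2) * cos q :=
    hcont.mul continuous_cos
  rw [← integral_sqrtIm_div_mul_cos hs, ← intervalIntegral.integral_sub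
    (hcont.intervalIntegrable _ _) (hcont'.intervalIntegrable _ _)]
  have h := intervalIntegral.norm_integral_le_of_norm_le_const (a := 0) (b := π / 2) (C := √s)
    (f := fun q => sqrtIm s (sin q) / √(sin q ^ 4 + s ^ 2) -
      sqrtIm s (sin q) / √(sin q ^ 4 + s ^ 2) * cos q) ?_
  · rwa [sub_zero, abs_of_pos (by positivity : 0 < π / 2), Real.norm_eq_abs] at h
  intro q hq
  rw [Set.uIoc_of_le (by positivity)] at hq
  have hcos : 0 ≤ cos q := cos_nonneg_of_mem_Icc ⟨by linarith [hq.1, pi_pos], hq.2⟩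
  have hF : 0 ≤ sqrtIm s (sin q) / √(sin q ^ 4 + s ^ 2) :=
    div_nonneg (Real.sqrt_nonneg _) (Real.sqrt_nonneg _)
  have hle : 1 - cos q ≤ sin q ^ 2 := by nlinarith [sin_sq_add_cos_sq q, cos_le_one q]
  rw [← mul_one_sub, Real.norm_eq_abs, abs_of_nonneg
    (mul_nonneg hF (by linarith [cos_le_one q]))]
  exact (mul_le_mul_of_nonneg_left hle hF).trans (sqrtIm_div_mul_sq_le hs _)

lemma integral_comp_sin_zero_pi {f : ℝ → ℝ} (hf : Continuous fun q => f (sin q)) :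
    ∫ q in (0 : ℝ)..π, f (sin q) = 2 * ∫ q in (0 : ℝ)..π / 2, f (sin q) := by
  have h := intervalIntegral.integral_comp_sub_left (a := π / 2) (b := π)
    (fun q => f (sin q)) π
  simp only [sin_pi_sub, sub_self, sub_half] at h
  rw [← intervalIntegral.integral_add_adjacent_intervals (hf.intervalIntegrable 0 (π / 2))
    (hf.intervalIntegrable (π / 2) π), h]
  ring

lemma tendsto_arctan_sqrtIm_one :
    Tendsto (fun s => arctan (sqrtIm s 1 / (1 + sqrtRe s 1))) (𝓝 0) (𝓝 0) := by
  have h : Continuous fun s => arctan (sqrtIm s 1 / (1 + sqrtRe s 1)) := by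
    unfold sqrtIm sqrtRe
    refine continuous_arctan.comp (Continuous.div (by fun_prop) (by fun_prop) fun s => ?_)
    positivity
  simpa [sqrtIm] using h.tendsto 0

theorem h2_full_asymptotics :
    Filter.Tendsto
      (fun s : ℝ =>
        ∫ q in (0:ℝ)..Real.pi,
          Real.sqrt ((Real.sqrt (Real.sin q ^ 4 + s ^ 2) - Real.sin q ^ 2) /
            (2 * (Real.sin q ^ 4 + s ^ 2))))
      (nhdsWithin 0 (Set.Ioi 0)) (nhds (Real.pi / 2)) := by
  simp only [sqrt_div_eq_sqrtIm_div]
  have hdiff : Tendsto (fun s : ℝ =>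
      (∫ q in (0 : ℝ)..π / 2, sqrtIm s (sin q) / √(sin q ^ 4 + s ^ 2)) -
        (π / 4 - arctan (sqrtIm s 1 / (1 + sqrtRe s 1)))) (𝓝[>] 0) (𝓝 0) := by
    have hbound : Tendsto (fun s : ℝ => √s * (π / 2)) (𝓝[>] 0) (𝓝 0) := by
      have h : Continuous fun s : ℝ => √s * (π / 2) := by fun_prop
      simpa using (h.tendsto 0).mono_left nhdsWithin_le_nhds
    refine squeeze_zero_norm' ?_ hbound
    filter_upwards [self_mem_nhdsWithin] with s hs
    exact abs_integral_sqrtIm_div_sub_le hs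
  have hmain := (hdiff.add ((tendsto_arctan_sqrtIm_one.mono_left
    nhdsWithin_le_nhds).const_sub (π / 4))).const_mul 2
  rw [show (2 : ℝ) * (0 + (π / 4 - 0)) = π / 2 by ring] at hmain
  refine hmain.congr' ?_
  filter_upwards [self_mem_nhdsWithin] with s hs
  rw [sub_add_cancel]
  exact (integral_comp_sin_zero_pi (f := fun x => sqrtIm s x / √(x ^ 4 + s ^ 2))
    (continuous_sqrtIm_div hs)).symm
end
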